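/- arXiv:1206.4436 — 3 statements merged into one kernel-verified Lean document; each statement's English description precedes it below -/
import Mathlib

section
/- Let n ≡ 2 (mod 3) and let T ⊆ ℤ^n be a perfect Lee code of radius 1 with 0 ∈ T. Then for each signed coordinate direction (i, ε) there is at most one codeword of type [2^2] (two coordinates ±2, rest 0) with i-th coordinate equal to 2ε; consequently T contains at most n codewords of type [2^2]. -/
/-- `T ⊆ ℤ^n` is a perfect Lee code of radius 1. -/
def PerfectLeeCode (n : ℕ) (T : Set (Fin n → ℤ)) : Prop :=
  ∀ x : Fin n → ℤ, ∃! t, t ∈ T ∧ ∑ i, |x i - t i| ≤ 1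

/-- Type [2^2]: two coordinates equal to ±2, the rest 0. -/
def IsType22 {n : ℕ} (W : Fin n → ℤ) : Prop :=
  ∃ i j, i ≠ j ∧ |W i| = 2 ∧ |W j| = 2 ∧ ∀ k, k ≠ i → k ≠ j → W k = 0

open Finset in
/-- If the translates of a finite set `V` of odd size by `T` tile an abelian group, every element
has an odd number of representations `t + 2v`. -/
theorem odd_card_filter_sub_add_self {G : Type*} [AddCommGroup G] [DecidableEq G]
    (T : Set G) [DecidablePred (· ∈ T)] (V : Finset G) (hV : Odd #V)
    (hTV : ∀ x, #{v ∈ V | x - v ∈ T} = 1) (x : G) :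
    Odd #{v ∈ V | x - (v + v) ∈ T} := by
  let a : G × G → ZMod 2 := fun p => if x - (p.1 + p.2) ∈ T then 1 else 0
  have total : ∑ p ∈ V ×ˢ V, a p = 1 := by
    rw [sum_product]
    have inner : ∀ v ∈ V, ∑ w ∈ V, a (v, w) = 1 := by
      intro v _
      simp only [a, ← sub_sub, sum_boole, hTV, Nat.cast_one]
    rw [sum_congr rfl inner, sum_const, nsmul_one, ZMod.natCast_eq_one_iff_odd]
    exact hV
  have off : ∑ p ∈ V.offDiag, a p = 0 := by
    refine sum_involution (fun p _ => p.swap) ?_ ?_ ?_ ?_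
    · intro p _
      simp only [a, Prod.fst_swap, Prod.snd_swap, add_comm p.2 p.1]
      exact CharTwo.add_self_eq_zero _
    · intro p hp _ h
      exact (mem_offDiag.1 hp).2.2 (congrArg Prod.snd h)
    · intro p hp
      simp only [mem_offDiag, Prod.fst_swap, Prod.snd_swap] at hp ⊢
      exact ⟨hp.2.1, hp.1, hp.2.2.symm⟩
    · intro p _
      exact p.swap_swap
  rw [← diag_union_offDiag, sum_union (disjoint_diag_offDiag V), off, add_zero, sum_diag] at total
  simpa only [a, sum_boole, ZMod.natCast_eq_one_iff_odd] using total

open Finset in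
/-- If the translates of a finite set `V` of odd size by `T` tile an abelian group, then so do
the translates of `2V`. -/
theorem card_filter_sub_add_self_eq_one {G : Type*} [AddCommGroup G] [DecidableEq G]
    (T : Set G) [DecidablePred (· ∈ T)] (V : Finset G) (hV : Odd #V)
    (hTV : ∀ x, #{v ∈ V | x - v ∈ T} = 1) (x : G) :
    #{v ∈ V | x - (v + v) ∈ T} = 1 := by
  obtain ⟨u, hu⟩ : V.Nonempty := card_pos.1 hV.pos
  have total : ∑ v ∈ V, 1 = ∑ v ∈ V, #{w ∈ V | x + u - v - (w + w) ∈ T} := by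
    simp only [card_filter]
    rw [sum_comm]
    refine sum_congr rfl fun w _ => ?_
    simp only [sub_right_comm (x + u) _ (w + w), ← card_filter, hTV]
  have le : ∀ v ∈ V, 1 ≤ #{w ∈ V | x + u - v - (w + w) ∈ T} := fun v _ =>
    (odd_card_filter_sub_add_self T V hV hTV _).pos
  have eq := (sum_eq_sum_iff_of_le le).1 total u hu
  rw [add_sub_cancel_right] at eq
  exact eq.symm

/-- The Lee ball of radius 1 around the origin. -/
noncomputable def leeBall (n : ℕ) : Finset (Fin n → ℤ) :=
  {v ∈ Finset.Icc (-1) 1 | ∑ i, |v i| ≤ 1}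

theorem mem_leeBall {n : ℕ} {v : Fin n → ℤ} : v ∈ leeBall n ↔ ∑ i, |v i| ≤ 1 := by
  simp only [leeBall, Finset.mem_filter, Finset.mem_Icc, and_iff_right_iff_imp]
  intro h
  have bound (i : Fin n) : |v i| ≤ 1 :=
    (Finset.single_le_sum (fun j _ => abs_nonneg (v j)) (Finset.mem_univ i)).trans h
  exact ⟨fun i => (abs_le.1 (bound i)).1, fun i => (abs_le.1 (bound i)).2⟩

theorem odd_card_leeBall (n : ℕ) : Odd (leeBall n).card := by
  have h0 : (0 : Fin n → ℤ) ∈ leeBall n := by simp [mem_leeBall]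
  have pairs : ∑ _v ∈ (leeBall n).erase 0, (1 : ZMod 2) = 0 := by
    refine Finset.sum_involution (fun v _ => -v) ?_ ?_ ?_ ?_
    · intro v _
      exact CharTwo.add_self_eq_zero _
    · intro v hv _ h
      exact (Finset.mem_erase.1 hv).1 (self_eq_neg.1 h.symm)
    · intro v hv
      simpa [mem_leeBall] using hv
    · intro v _
      exact neg_neg v
  rw [← ZMod.natCast_eq_one_iff_odd, ← Finset.card_erase_add_one h0]
  simpa using pairs

open scoped Classical in
theorem PerfectLeeCode.card_filter_leeBall {n : ℕ} {T : Set (Fin n → ℤ)}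
    (hT : PerfectLeeCode n T) (x : Fin n → ℤ) :
    ((leeBall n).filter (fun v => x - v ∈ T)).card = 1 := by
  obtain ⟨t, ⟨ht, hxt⟩, unique⟩ := hT x
  refine Finset.card_eq_one.2 ⟨x - t, Finset.ext fun v => ?_⟩
  simp only [Finset.mem_filter, Finset.mem_singleton, mem_leeBall]
  constructor
  · rintro ⟨hv, hvT⟩
    rw [← unique (x - v) ⟨hvT, by simpa using hv⟩, sub_sub_cancel]
  · rintro rfl
    exact ⟨hxt, by rwa [sub_sub_cancel]⟩

/-- A perfect Lee code of radius 1 containing the origin has no codeword of type [2^2]. -/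
theorem PerfectLeeCode.not_isType22 {n : ℕ} {T : Set (Fin n → ℤ)}
    (hT : PerfectLeeCode n T) (h0 : 0 ∈ T) {W : Fin n → ℤ} (hW : W ∈ T) : ¬ IsType22 W := by
  classical
  rintro ⟨i, j, hij, hi, hj, hk⟩
  have half {m : Fin n} (hm : |W m| = 2) : ∃ c : ℤ, |c| = 1 ∧ W m = c + c := by
    rcases (abs_eq (by norm_num)).1 hm with h | h
    · exact ⟨1, by simp, by omega⟩
    · exact ⟨-1, by simp, by omega⟩
  obtain ⟨a, ha, hWa⟩ := half hi
  obtain ⟨b, hb, hWb⟩ := half hj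
  have mem_ball (m : Fin n) {c : ℤ} (hc : |c| = 1) : Pi.single m c ∈ leeBall n := by
    rw [mem_leeBall, Finset.sum_eq_single m]
    · simp [hc]
    · intro k _ hkm
      simp [hkm]
    · simp
  have hWeq : W = (Pi.single i a + Pi.single i a) - (Pi.single j (-b) + Pi.single j (-b)) := by
    funext k
    by_cases hki : k = i
    · subst hki
      simp [hij, hWa]
    · by_cases hkj : k = j
      · subst hkj
        simp [hki, hWb]
      · simp [hki, hkj, hk k hki hkj]
  have card := card_filter_sub_add_self_eq_one T (leeBall n) (odd_card_leeBall n)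
    hT.card_filter_leeBall (Pi.single i a + Pi.single i a)
  have eq : (Pi.single i a : Fin n → ℤ) = Pi.single j (-b) := by
    refine Finset.card_le_one.1 card.le _ ?_ _ ?_
    · exact Finset.mem_filter.2 ⟨mem_ball i ha, by rwa [sub_self]⟩
    · exact Finset.mem_filter.2 ⟨mem_ball j (by rwa [abs_neg]), by rwa [← hWeq]⟩
  have ha0 : a = 0 := by simpa [hij] using congrFun eq i
  simp [ha0] at ha

/-- For `n ≡ 2 (mod 3)`: for each signed direction there is at most one codeword
of type [2^2] with that signed coordinate equal to `2ε`, hence at most `n`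
codewords of type [2^2] in total. -/
theorem count_22 (n : ℕ) (hn : n % 3 = 2) (T : Set (Fin n → ℤ))
    (hT : PerfectLeeCode n T) (h0 : 0 ∈ T) :
    (∀ (i : Fin n) (ε : ℤ), ε = 1 ∨ ε = -1 →
      {W ∈ T | IsType22 W ∧ W i = 2 * ε}.Subsingleton) ∧
    {W ∈ T | IsType22 W}.ncard ≤ n := by
  refine ⟨fun i ε _ W hW => absurd hW.2.1 (hT.not_isType22 h0 hW.1), ?_⟩
  have empty : {W ∈ T | IsType22 W} = ∅ :=
    Set.eq_empty_of_forall_notMem fun W hW => hT.not_isType22 h0 hW.1 hW.2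
  simp [empty]
end

section
/- Let n ≡ 2 (mod 3) and let T ⊆ ℤ^n be a perfect Lee code of radius 1 with 0 ∈ T. Writing s for the number of codewords of type [5^1] (words ±5e_i), the number of codewords of type [4^1,1^1] equals 2n - s and the number of codewords of type [3^1,2^1] equals 2n - s. -/
/-- Type [5^1]: one coordinate equal to ±5, the rest 0. -/
def IsType51 {n : ℕ} (W : Fin n → ℤ) : Prop :=
  ∃ i, |W i| = 5 ∧ ∀ k, k ≠ i → W k = 0

/-- Type [4^1,1^1]: one coordinate ±4, one other coordinate ±1, the rest 0. -/
def IsType4111 {n : ℕ} (W : Fin n → ℤ) : Prop :=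
  ∃ i j, i ≠ j ∧ |W i| = 4 ∧ |W j| = 1 ∧ ∀ k, k ≠ i → k ≠ j → W k = 0

/-- Type [3^1,2^1]: one coordinate ±3, one other coordinate ±2, the rest 0. -/
def IsType3121 {n : ℕ} (W : Fin n → ℤ) : Prop :=
  ∃ i j, i ≠ j ∧ |W i| = 3 ∧ |W j| = 2 ∧ ∀ k, k ≠ i → k ≠ j → W k = 0

/-- `A` and the tile `k • v` (indexed by `ι`) form a tiling: each `x` is uniquely `k • v i + a`
with `a ∈ A`. -/
def TilesAtScale {ι V : Type*} [AddCommGroup V] (v : ι → V) (A : Set V) (k : ℕ) : Prop :=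
  ∀ x, ∃! i, x - k • v i ∈ A

lemma sum_indicator_eq_one_iff {ι α : Type*} [Fintype ι] {A : Set α} {y : ι → α} :
    ∑ i, A.indicator (1 : α → ℕ) (y i) = 1 ↔ ∃! i, y i ∈ A := by
  classical
  simp only [Set.indicator_apply, Pi.one_apply, Finset.sum_boole, Nat.cast_id,
    Finset.card_eq_one, Finset.eq_singleton_iff_unique_mem, Finset.mem_filter, Finset.mem_univ,
    true_and, ExistsUnique]

section Dilation

variable {ι V : Type*} [Fintype ι] [AddCommGroup V]

/-- Translation of functions, as a homomorphism into the algebra of linear endomorphisms. -/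
def translationHom (R V : Type*) [CommRing R] [AddCommGroup V] :
    Multiplicative V →* Module.End R (V → R) where
  toFun w :=
    { toFun := fun g x => g (x - w.toAdd)
      map_add' := fun _ _ => rfl
      map_smul' := fun _ _ => rfl }
  map_one' := by ext g x; simp
  map_mul' a b := by
    refine LinearMap.ext fun g => funext fun x => ?_
    simp [sub_sub]

lemma translationHom_apply {R : Type*} [CommRing R] (w : V) (g : V → R) (x : V) :
    translationHom R V (Multiplicative.ofAdd w) g x = g (x - w) := rfl

/-- Covering multiplicities of the tile dilated by a prime `p` are congruent to `1` mod `p`. -/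
lemma sum_indicator_dilate_zmod {v : ι → V} {A : Set V} (hA : TilesAtScale v A 1)
    (p : ℕ) [Fact p.Prime] (hp : ¬ p ∣ Fintype.card ι) (x : V) :
    ((∑ i, A.indicator (1 : V → ℕ) (x - p • v i) : ℕ) : ZMod p) = 1 := by
  let L := AddMonoidAlgebra.lift (ZMod p) (Module.End (ZMod p) (V → ZMod p)) V
    (translationHom (ZMod p) V)
  let S : AddMonoidAlgebra (ZMod p) V := ∑ i, AddMonoidAlgebra.single (v i) 1
  let χ : V → ZMod p := fun y => (A.indicator (1 : V → ℕ) y : ℕ)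
  have hL (w : ι → V) (g : V → ZMod p) (y : V) :
      L (∑ i, AddMonoidAlgebra.single (w i) 1) g y = ∑ i, g (y - w i) := by
    simp [L, AddMonoidAlgebra.lift_single, translationHom_apply, LinearMap.sum_apply,
      Finset.sum_apply]
  have hχ : L S χ = 1 := by
    funext y
    have h := sum_indicator_eq_one_iff.2 (hA y)
    simp only [one_smul] at h
    rw [hL, ← Nat.cast_sum, h]
    simp
  have hone : L S 1 = (Fintype.card ι : ZMod p) • (1 : V → ZMod p) := by
    funext y
    rw [hL]
    simp
  have hpow (k : ℕ) : L (S ^ (k + 1)) χ = (Fintype.card ι : ZMod p) ^ k • (1 : V → ZMod p) := by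
    induction k with
    | zero => simp [hχ]
    | succ k ih =>
      rw [pow_succ', map_mul, Module.End.mul_apply, ih, map_smul, hone, smul_smul, ← pow_succ]
  have hfrob : S ^ p = ∑ i, AddMonoidAlgebra.single (p • v i) 1 := by
    have : CharP (AddMonoidAlgebra (ZMod p) V) p :=
      charP_of_injective_algebraMap
        (FaithfulSMul.algebraMap_injective (ZMod p) (AddMonoidAlgebra (ZMod p) V)) p
    simp only [S, sum_pow_char, AddMonoidAlgebra.single_pow, one_pow]
  have hcard : (Fintype.card ι : ZMod p) ≠ 0 := by
    rwa [Ne, ZMod.natCast_eq_zero_iff]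
  have h := hpow (p - 1)
  rw [Nat.sub_add_cancel (Fact.out : p.Prime).one_le, ZMod.pow_card_sub_one_eq_one hcard,
    one_smul, hfrob] at h
  have h' := congrFun h x
  rw [hL] at h'
  rw [Nat.cast_sum]
  exact h'

/-- A tiling remains a tiling when the tile is dilated by a prime not dividing its size. -/
theorem TilesAtScale.dilate_prime {v : ι → V} {A : Set V} (hA : TilesAtScale v A 1)
    (p : ℕ) [Fact p.Prime] (hp : ¬ p ∣ Fintype.card ι) : TilesAtScale v A p := by
  set m : V → ℕ := fun x => ∑ i, A.indicator (1 : V → ℕ) (x - p • v i) with hm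
  have hpos (x : V) : 1 ≤ m x := by
    refine Nat.one_le_iff_ne_zero.2 fun h => ?_
    have h1 := sum_indicator_dilate_zmod hA p hp x
    change ((m x : ℕ) : ZMod p) = 1 at h1
    rw [h] at h1
    simp at h1
  have hsum (x : V) : ∑ i, m (x - v i) = ∑ _i : ι, 1 := by
    simp only [hm]
    rw [Finset.sum_comm]
    refine Finset.sum_congr rfl fun j _ => ?_
    have h := sum_indicator_eq_one_iff.2 (hA (x - p • v j))
    simpa only [one_smul, sub_right_comm] using h
  intro x
  obtain ⟨i, -⟩ := (hA x).exists
  refine sum_indicator_eq_one_iff.1 ?_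
  have h := (Finset.sum_eq_sum_iff_of_le fun j _ => hpos (x + v i - v j)).1
    (hsum (x + v i)).symm i (Finset.mem_univ i)
  rw [add_sub_cancel_right] at h
  exact h.symm

end Dilation

/-- The points of the Lee sphere of radius `1` in `ℤ^n`. -/
def crossPoint (n : ℕ) : Option (Fin n × ℤˣ) → Fin n → ℤ
  | none => 0
  | some (i, u) => Pi.single i (u : ℤ)

lemma sum_abs_le_one_iff {n : ℕ} (w : Fin n → ℤ) :
    ∑ i, |w i| ≤ 1 ↔ ∃ c, crossPoint n c = w := by
  constructor
  · intro h
    by_cases hw : w = 0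
    · exact ⟨none, hw.symm⟩
    obtain ⟨i, hi⟩ := Function.ne_iff.1 hw
    have hi1 : 1 ≤ |w i| := Int.one_le_abs hi
    have hsplit := Finset.add_sum_erase Finset.univ (fun k => |w k|) (Finset.mem_univ i)
    have hrest : ∀ k, k ≠ i → w k = 0 := by
      intro k hk
      have := Finset.single_le_sum (f := fun k => |w k|) (fun k _ => abs_nonneg (w k))
        (Finset.mem_erase.2 ⟨hk, Finset.mem_univ k⟩)
      exact abs_eq_zero.1 (le_antisymm (by linarith) (abs_nonneg _))
    have habs : |w i| ≤ 1 := by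
      have := Finset.sum_nonneg (s := Finset.univ.erase i) fun k _ => abs_nonneg (w k)
      linarith
    obtain ⟨u, hu⟩ := Int.isUnit_iff_abs_eq.2 (le_antisymm habs hi1)
    refine ⟨some (i, u), funext fun k => ?_⟩
    by_cases hk : k = i
    · subst hk
      simp [crossPoint, hu]
    · simp [crossPoint, hk, hrest k hk]
  · rintro ⟨_ | ⟨i, u⟩, rfl⟩
    · simp [crossPoint]
    · rw [Finset.sum_eq_single i]
      · simp [crossPoint, Int.isUnit_iff_abs_eq.1 u.isUnit]
      · intro k _ hk
        simp [crossPoint, hk]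
      · simp

lemma crossPoint_injective (n : ℕ) : Function.Injective (crossPoint n) := by
  rintro (_ | ⟨i, u⟩) (_ | ⟨j, w⟩) h
  · rfl
  · have := congrFun h j
    exact absurd (by simpa [crossPoint] using this.symm) w.ne_zero
  · have := congrFun h i
    simp [crossPoint] at this
  · have hi := congrFun h i
    by_cases hij : i = j
    · subst hij
      simp only [crossPoint, Pi.single_eq_same, Units.val_inj] at hi
      rw [hi]
    · simp [crossPoint, hij] at hi

lemma PerfectLeeCode.tilesAtScale_one {n : ℕ} {T : Set (Fin n → ℤ)} (hT : PerfectLeeCode n T) :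
    TilesAtScale (crossPoint n) T 1 := by
  intro x
  obtain ⟨t, ⟨htT, ht⟩, huniq⟩ := hT x
  obtain ⟨c, hc⟩ := (sum_abs_le_one_iff fun i => x i - t i).1 ht
  have hc' : crossPoint n c = x - t := hc
  refine ⟨c, by simpa [hc'] using htT, fun d hd => crossPoint_injective n ?_⟩
  simp only [one_smul] at hd
  have := huniq _ ⟨hd, (sum_abs_le_one_iff _).2 ⟨d, by funext i; simp⟩⟩
  rw [hc', ← this, sub_sub_cancel]

section AxisWords

variable {n : ℕ} {T : Set (Fin n → ℤ)} {k : ℕ}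

lemma TilesAtScale.single_notMem (hk : TilesAtScale (crossPoint n) T k) (h0 : 0 ∈ T)
    (i : Fin n) (u : ℤˣ) : Pi.single i ((k : ℤ) * u) ∉ T := by
  intro h
  have := (hk (Pi.single i ((k : ℤ) * u))).unique (y₁ := none) (y₂ := some (i, u))
    (by simpa [crossPoint] using h)
    (by simpa [crossPoint, ← Pi.single_smul] using h0)
  simp at this

lemma TilesAtScale.single_two_mul_notMem (hk : TilesAtScale (crossPoint n) T k) (h0 : 0 ∈ T)
    (i : Fin n) (u : ℤˣ) : Pi.single i ((2 * k : ℤ) * u) ∉ T := by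
  intro h
  have := (hk (Pi.single i ((k : ℤ) * u))).unique (y₁ := some (i, -u)) (y₂ := some (i, u))
    (by
      convert h using 1
      simp only [crossPoint, ← Pi.single_smul, ← Pi.single_sub]
      congr 1
      simp
      ring)
    (by simpa [crossPoint, ← Pi.single_smul] using h0)
  simp at this

lemma units_int_eq_or_eq_neg : ∀ u w : ℤˣ, u = w ∨ u = -w := by decide

lemma exists_unit_mul_abs (z : ℤ) : ∃ u : ℤˣ, z = |z| * u := by
  rcases abs_choice z with h | h
  · exact ⟨1, by simp [h]⟩
  · exact ⟨-1, by simp [h]⟩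

/-- If no codeword lies at `a • (±eᵢ)` or `(a - k) • (±eᵢ)`, then covering the points `a • (±eᵢ)`
by the cross dilated by `k < a` uses each word of type `[a, k]` or `[a + k]` exactly once. -/
lemma TilesAtScale.ncard_add_ncard (hk : TilesAtScale (crossPoint n) T k) {a b : ℤ}
    (hk0 : 0 < k) (hka : (k : ℤ) < a) (hb : b = a + k)
    (ha : ∀ i (u : ℤˣ), Pi.single i (a * u) ∉ T)
    (hak : ∀ i (u : ℤˣ), Pi.single i ((a - k) * u) ∉ T) :
    {W ∈ T | ∃ i j, i ≠ j ∧ |W i| = a ∧ |W j| = k ∧ ∀ l, l ≠ i → l ≠ j → W l = 0}.ncard +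
      {W ∈ T | ∃ i, |W i| = b ∧ ∀ l, l ≠ i → W l = 0}.ncard = 2 * n := by
  subst hb
  set X := {W ∈ T | ∃ i j, i ≠ j ∧ |W i| = a ∧ |W j| = k ∧ ∀ l, l ≠ i → l ≠ j → W l = 0}
  set Y := {W ∈ T | ∃ i, |W i| = a + k ∧ ∀ l, l ≠ i → W l = 0}
  have hkpos : (0 : ℤ) < k := by exact_mod_cast hk0
  choose c hc hcu using fun q : Fin n × ℤˣ => hk (Pi.single q.1 (a * q.2))
  let φ : Fin n × ℤˣ → Fin n → ℤ :=
    fun q => Pi.single q.1 (a * q.2) - k • crossPoint n (c q)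
  have hcases (q : Fin n × ℤˣ) : (∃ j w, j ≠ q.1 ∧ c q = some (j, w)) ∨ c q = some (q.1, -q.2) := by
    have h := hc q
    rcases hcq : c q with _ | ⟨j, w⟩
    · simp only [hcq, crossPoint, smul_zero, sub_zero] at h
      exact absurd h (ha _ _)
    · by_cases hj : j = q.1
      · right
        subst hj
        rcases units_int_eq_or_eq_neg w q.2 with rfl | rfl
        · refine absurd ?_ (hak q.1 q.2)
          simp only [hcq, crossPoint, ← Pi.single_smul, ← Pi.single_sub, nsmul_eq_mul] at h
          rwa [sub_mul]
        · rfl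
      · exact Or.inl ⟨j, w, hj, rfl⟩
  have hunit (u : ℤˣ) : |(u : ℤ)| = 1 := Int.isUnit_iff_abs_eq.1 u.isUnit
  have hsame (u : ℤˣ) : (u : ℤ) * u = 1 := by
    rcases Int.units_eq_one_or u with rfl | rfl <;> rfl
  have hval (q : Fin n × ℤˣ) :
      a ≤ q.2 * φ q q.1 ∧ ∀ l, l ≠ q.1 → |φ q l| ≤ k := by
    rcases hcases q with ⟨j, w, hj, h⟩ | h
    · refine ⟨?_, fun l hl => ?_⟩
      · simp only [φ, h, crossPoint, Pi.sub_apply, Pi.smul_apply, Pi.single_eq_same,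
          Pi.single_eq_of_ne hj.symm, smul_zero, sub_zero]
        linear_combination (-a) * hsame q.2
      · by_cases hlj : l = j
        · subst hlj
          simp [φ, h, crossPoint, hl, abs_mul, hunit]
        · simp [φ, h, crossPoint, hl, hlj]
    · refine ⟨?_, fun l hl => ?_⟩
      · simp only [φ, h, crossPoint, Pi.sub_apply, Pi.smul_apply, Pi.single_eq_same,
          Units.val_neg]
        rw [nsmul_eq_mul]
        linear_combination (-a - k) * hsame q.2 + hkpos
      · simp [φ, h, crossPoint, hl]
  have hinj : Function.Injective φ := by
    rintro ⟨i, u⟩ ⟨j, w⟩ h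
    obtain ⟨h1, h2⟩ := hval (i, u)
    obtain ⟨h3, h4⟩ := hval (j, w)
    rw [h] at h1 h2
    simp only at h1 h2 h3 h4
    obtain rfl : i = j := by
      by_contra hij
      have h5 := h4 i hij
      have h6 := le_abs_self ((u : ℤ) * φ (j, w) i)
      rw [abs_mul, hunit, one_mul] at h6
      linarith
    rcases units_int_eq_or_eq_neg u w with rfl | rfl
    · rfl
    · simp only [Units.val_neg, neg_mul] at h1
      linarith
  have hrange : Set.range φ = X ∪ Y := by
    ext W
    constructor
    · rintro ⟨q, rfl⟩
      rcases hcases q with ⟨j, w, hj, h⟩ | h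
      · refine Or.inl ⟨hc q, q.1, j, hj.symm, ?_, ?_, fun l hl hlj => ?_⟩
        · simp [φ, h, crossPoint, hj.symm, abs_mul, hunit, abs_of_pos (hkpos.trans hka)]
        · simp [φ, h, crossPoint, hj, abs_mul, hunit]
        · simp [φ, h, crossPoint, hl, hlj]
      · refine Or.inr ⟨hc q, q.1, ?_, fun l hl => ?_⟩
        · simp [φ, h, crossPoint, ← add_mul, abs_mul, hunit,
            abs_of_pos (add_pos (hkpos.trans hka) hkpos)]
        · simp [φ, h, crossPoint, hl]
    · rintro (⟨hW, i, j, hij, hi, hj, hl⟩ | ⟨hW, i, hi, hl⟩)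
      · obtain ⟨u, hu⟩ := exists_unit_mul_abs (W i)
        obtain ⟨w, hw⟩ := exists_unit_mul_abs (W j)
        rw [hi] at hu
        rw [hj] at hw
        have heq : W = Pi.single i (a * u) - k • crossPoint n (some (j, -w)) := by
          funext l
          by_cases h1 : l = i
          · subst h1
            simp [crossPoint, hij, hu]
          · by_cases h2 : l = j
            · subst h2
              simp [crossPoint, h1, hw]
            · simp [crossPoint, h1, h2, hl l h1 h2]
        refine ⟨(i, u), ?_⟩
        rw [heq] at hW ⊢
        simp only [φ, hcu (i, u) _ hW]
      · obtain ⟨u, hu⟩ := exists_unit_mul_abs (W i)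
        rw [hi] at hu
        have heq : W = Pi.single i (a * u) - k • crossPoint n (some (i, -u)) := by
          funext l
          by_cases h1 : l = i
          · subst h1
            simp [crossPoint, hu, add_mul]
          · simp [crossPoint, h1, hl l h1]
        refine ⟨(i, u), ?_⟩
        rw [heq] at hW ⊢
        simp only [φ, hcu (i, u) _ hW]
  have hdisj : Disjoint X Y := by
    rw [Set.disjoint_left]
    rintro W ⟨-, i, j, hij, hi, hj, -⟩ ⟨-, m, hm, hl⟩
    have him : i = m := by
      by_contra h
      rw [hl i h, abs_zero] at hi
      linarith
    have hjm : j = m := by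
      by_contra h
      rw [hl j h, abs_zero] at hj
      linarith
    exact hij (him.trans hjm.symm)
  have hfin : (X ∪ Y).Finite := hrange ▸ Set.finite_range φ
  rw [← Set.ncard_union_eq hdisj (hfin.subset Set.subset_union_left)
    (hfin.subset Set.subset_union_right), ← hrange, Set.ncard_range_of_injective hinj]
  simp [mul_comm]

end AxisWords

/-- For `n ≡ 2 (mod 3)`: writing `s` for the number of codewords of type [5^1],
there are `2n - s` codewords of type [4^1,1^1] and `2n - s` of type [3^1,2^1]. -/
theorem counts_4111_3121 (n : ℕ) (hn : n % 3 = 2) (T : Set (Fin n → ℤ))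
    (hT : PerfectLeeCode n T) (h0 : 0 ∈ T) :
    {W ∈ T | IsType4111 W}.ncard + {W ∈ T | IsType51 W}.ncard = 2 * n ∧
    {W ∈ T | IsType3121 W}.ncard + {W ∈ T | IsType51 W}.ncard = 2 * n := by
  have hcard : Fintype.card (Option (Fin n × ℤˣ)) = 2 * n + 1 := by
    simp [mul_comm]
  have h1 := hT.tilesAtScale_one
  have h2 := h1.dilate_prime 2 (by rw [hcard]; omega)
  have h3 := h1.dilate_prime 3 (by rw [hcard]; omega)
  exact ⟨h1.ncard_add_ncard (a := 4) (b := 5) (by norm_num) (by norm_num) (by norm_num)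
      (h2.single_two_mul_notMem h0) (h3.single_notMem h0),
    h2.ncard_add_ncard (a := 3) (b := 5) (by norm_num) (by norm_num) (by norm_num)
      (h3.single_notMem h0) (h1.single_notMem h0)⟩
end

section
/- Let T ⊆ ℤ^5 be a perfect Lee code of radius 1 with 0 ∈ T. Then T contains no codeword W with |W|_M = 5 having a single nonzero coordinate (type [5^1]), and T contains exactly two codewords all of whose coordinates are ±1 (type [1^5]); moreover these two codewords are negatives of each other. -/
open Finset

section Translation

variable {R G ι : Type*} [CommRing R] [AddCommGroup G]

/-- The action of an additive group on functions by translation of the argument. -/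
def translation (R G : Type*) [CommRing R] [AddCommGroup G] :
    Multiplicative G →* Module.End R (G → R) where
  toFun g := LinearMap.funLeft R R (· + g.toAdd)
  map_one' := by ext f x; simp [LinearMap.funLeft]
  map_mul' g h := by ext f x; simp [LinearMap.funLeft, add_assoc]

/-- The induced action of the group algebra on functions. -/
noncomputable def groupAlgebraAction (R G : Type*) [CommRing R] [AddCommGroup G] :
    AddMonoidAlgebra R G →ₐ[R] Module.End R (G → R) :=
  AddMonoidAlgebra.lift R (Module.End R (G → R)) G (translation R G)

lemma groupAlgebraAction_single (g : G) (r : R) (f : G → R) (x : G) :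
    groupAlgebraAction R G (AddMonoidAlgebra.single g r) f x = r * f (x + g) := by
  simp [groupAlgebraAction, translation, LinearMap.funLeft]

lemma groupAlgebraAction_sum_single (s : Finset ι) (v : ι → G) (f : G → R) (x : G) :
    groupAlgebraAction R G (∑ j ∈ s, AddMonoidAlgebra.single (v j) 1) f x =
      ∑ j ∈ s, f (x + v j) := by
  simp [map_sum, groupAlgebraAction_single]

/-- The elements of the group algebra annihilating a given function. -/
noncomputable def annihilatorIdeal (f : G → R) : Ideal (AddMonoidAlgebra R G) where
  carrier := {a | groupAlgebraAction R G a f = 0}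
  add_mem' := by
    intro a b ha hb
    simp_all
  zero_mem' := by simp
  smul_mem' := by
    intro c a ha
    simp_all

lemma mem_annihilatorIdeal {f : G → R} {a : AddMonoidAlgebra R G} :
    a ∈ annihilatorIdeal f ↔ groupAlgebraAction R G a f = 0 := Iff.rfl

/-- If the translates of `f` by the `v j` sum to `1` over a ring of prime characteristic `p`, then
the translates by the `p • v j` sum to the constant `(card ι) ^ (p - 1)`. -/
lemma sum_translate_prime_smul [Fintype ι] (p : ℕ) [Fact p.Prime] (v : ι → G) (f : G → ZMod p)
    (hf : ∀ x, ∑ j, f (x + v j) = 1) (x : G) :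
    ∑ j, f (x + p • v j) = (Fintype.card ι : ZMod p) ^ (p - 1) := by
  have : CharP (AddMonoidAlgebra (ZMod p) G) p := charP_of_injective_algebraMap' (ZMod p) p
  set V : AddMonoidAlgebra (ZMod p) G := ∑ j, AddMonoidAlgebra.single (v j) 1 with hV
  have hpow : V ^ p = ∑ j, AddMonoidAlgebra.single (p • v j) 1 := by
    simp [hV, sum_pow_char, AddMonoidAlgebra.single_pow]
  have hiter (k : ℕ) : groupAlgebraAction (ZMod p) G (V ^ (k + 1)) f =
      fun _ => (Fintype.card ι : ZMod p) ^ k := by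
    induction k with
    | zero =>
      funext y
      rw [zero_add, pow_one, hV, groupAlgebraAction_sum_single, hf, pow_zero]
    | succ k ih =>
      rw [pow_succ', map_mul, Module.End.mul_apply, ih]
      funext y
      rw [hV, groupAlgebraAction_sum_single]
      simp [pow_succ']
  have hp : p - 1 + 1 = p := Nat.sub_add_cancel (Fact.out : p.Prime).one_le
  have := congrFun (hiter (p - 1)) x
  rwa [hp, hpow, groupAlgebraAction_sum_single] at this

end Translation

section Periodic

variable {n m : ℕ} {α : Type*}

lemma eq_of_intCast_eq {g : (Fin n → ℤ) → α} (hg : ∀ x y, g (x + (m : ℤ) • y) = g x)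
    {a b : Fin n → ℤ} (hab : ∀ i, (a i : ZMod m) = b i) : g a = g b := by
  have h (i : Fin n) : ∃ c, b i = a i + m * c := by
    obtain ⟨c, hc⟩ := (ZMod.intCast_eq_intCast_iff_dvd_sub _ _ _).1 (hab i)
    exact ⟨c, by linarith⟩
  choose c hc using h
  rw [show b = a + (m : ℤ) • c by ext i; simp [hc], hg]

lemma sum_period_translate [NeZero m] {g : (Fin n → ℤ) → ℤ}
    (hg : ∀ x y, g (x + (m : ℤ) • y) = g x) (v : Fin n → ℤ) :
    ∑ y : Fin n → ZMod m, g ((fun i => ((y i).val : ℤ)) + v) =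
      ∑ y : Fin n → ZMod m, g (fun i => ((y i).val : ℤ)) := by
  rw [← Equiv.sum_comp (Equiv.addRight (fun i => (v i : ZMod m)))
    (fun y : Fin n → ZMod m => g (fun i => ((y i).val : ℤ)))]
  refine sum_congr rfl fun y _ => eq_of_intCast_eq hg fun i => ?_
  simp

/-- A periodic nonnegative weight tiling with the multiset `v` also tiles with every dilate of `v`
by a prime not dividing the size of `v`. -/
lemma sum_translate_dilate [NeZero m] {ι : Type*} [Fintype ι] {F : (Fin n → ℤ) → ℤ}
    (hF : ∀ x, 0 ≤ F x) (hper : ∀ x y, F (x + (m : ℤ) • y) = F x) (v : ι → Fin n → ℤ)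
    (hv : ∀ x, ∑ j, F (x + v j) = 1) (p : ℕ) [Fact p.Prime]
    (hp : ¬ p ∣ Fintype.card ι) (x : Fin n → ℤ) : ∑ j, F (x + p • v j) = 1 := by
  have hmod (x) : ((∑ j, F (x + p • v j) : ℤ) : ZMod p) = 1 := by
    have h := sum_translate_prime_smul p v (fun y => (F y : ZMod p))
      (fun y => by exact_mod_cast congrArg (Int.cast : ℤ → ZMod p) (hv y)) x
    rw [ZMod.pow_card_sub_one_eq_one (by rwa [Ne, ZMod.natCast_eq_zero_iff])] at h
    exact_mod_cast h
  have hge (x) : 1 ≤ ∑ j, F (x + p • v j) := by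
    have h0 : 0 ≤ ∑ j, F (x + p • v j) := sum_nonneg fun j _ => hF _
    have h1 : ∑ j, F (x + p • v j) ≠ 0 := by
      intro h
      have := hmod x
      rw [h] at this
      simp at this
    omega
  have htotal (w : ι → Fin n → ℤ) :
      ∑ y : Fin n → ZMod m, ∑ j, F ((fun i => ((y i).val : ℤ)) + w j) =
        Fintype.card ι * ∑ y : Fin n → ZMod m, F (fun i => ((y i).val : ℤ)) := by
    rw [sum_comm]
    simp only [sum_period_translate hper, sum_const, card_univ, nsmul_eq_mul]
  have hsum : ∑ _y : Fin n → ZMod m, (1 : ℤ) =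
      ∑ y : Fin n → ZMod m, ∑ j, F ((fun i => ((y i).val : ℤ)) + p • v j) := by
    rw [htotal, ← htotal v]
    simp [hv]
  have hall := (sum_eq_sum_iff_of_le fun y _ => hge _).1 hsum
    (fun i => (x i : ZMod m)) (mem_univ _)
  rw [hall]
  refine sum_congr rfl fun j _ => eq_of_intCast_eq hper fun i => ?_
  simp

end Periodic

section Cross

/-- The `2 * n + 1` vectors `0`, `k e_i` and `-k e_i`. -/
def crossVec (n : ℕ) (k : ℤ) : Option (Fin n ⊕ Fin n) → Fin n → ℤ
  | none => 0
  | some (.inl i) => Pi.single i k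
  | some (.inr i) => Pi.single i (-k)

variable {n : ℕ}

lemma smul_crossVec (p : ℕ) (k : ℤ) (j : Option (Fin n ⊕ Fin n)) :
    p • crossVec n k j = crossVec n (p * k) j := by
  rcases j with _ | i | i <;> simp [crossVec, ← Pi.single_smul]

lemma crossVec_injective {k : ℤ} (hk : k ≠ 0) : Function.Injective (crossVec n k) := by
  rintro (_ | i | i) (_ | j | j) h
  · rfl
  all_goals
    try have hi := congrFun h i
    try have hj := congrFun h j
    simp only [crossVec, Pi.single_apply, Pi.zero_apply, if_true] at *
    grind

lemma sum_abs_crossVec_one_le (j : Option (Fin n ⊕ Fin n)) : ∑ i, |crossVec n 1 j i| ≤ 1 := by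
  rcases j with _ | i | i <;> simp [crossVec, Pi.single_apply, apply_ite abs]

lemma exists_crossVec_one_eq {d : Fin n → ℤ} (hd : ∑ i, |d i| ≤ 1) : ∃ j, d = crossVec n 1 j := by
  by_cases h : ∃ i, d i ≠ 0
  · obtain ⟨i, hi⟩ := h
    have hsplit := add_sum_erase univ (fun k => |d k|) (mem_univ i)
    have hrest : 0 ≤ ∑ k ∈ univ.erase i, |d k| := sum_nonneg fun k _ => abs_nonneg _
    have hpos := abs_pos.2 hi
    have hzero : ∑ k ∈ univ.erase i, |d k| = 0 := by omega
    have hk (k) (hki : k ≠ i) : d k = 0 :=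
      abs_eq_zero.1 ((sum_eq_zero_iff_of_nonneg fun k _ => abs_nonneg _).1 hzero k
        (mem_erase.2 ⟨hki, mem_univ _⟩))
    have hone : |d i| = 1 := by omega
    rcases eq_or_eq_neg_of_abs_eq hone with h1 | h1
    · refine ⟨some (.inl i), funext fun k => ?_⟩
      by_cases hki : k = i
      · subst hki; simp [crossVec, h1]
      · simp [crossVec, hki, hk]
    · refine ⟨some (.inr i), funext fun k => ?_⟩
      by_cases hki : k = i
      · subst hki; simp [crossVec, h1]
      · simp [crossVec, hki, hk]
  · push Not at h
    exact ⟨none, funext h⟩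

lemma card_cross : Fintype.card (Option (Fin n ⊕ Fin n)) = 2 * n + 1 := by
  simp [two_mul]

open Classical in
lemma PerfectLeeCode.sum_indicator {T : Set (Fin n → ℤ)} (hT : PerfectLeeCode n T)
    (x : Fin n → ℤ) : ∑ j, (if x + crossVec n 1 j ∈ T then (1 : ℤ) else 0) = 1 := by
  obtain ⟨t, ⟨htT, htx⟩, huniq⟩ := hT x
  obtain ⟨j, hj⟩ := exists_crossVec_one_eq (d := t - x) (by simpa [abs_sub_comm] using htx)
  have ht : t = x + crossVec n 1 j := by rw [← hj]; abel
  rw [Fintype.sum_eq_single j, if_pos (ht ▸ htT)]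
  intro l hl
  refine if_neg fun hlT => hl (crossVec_injective one_ne_zero (add_left_cancel (a := x) ?_))
  rw [← ht]
  exact huniq _ ⟨hlT, by simpa using sum_abs_crossVec_one_le l⟩

/-- A `0`-`1` function tiling with the cross of prime size `p` is `p`-periodic. -/
lemma periodic_of_sum_crossVec {F : (Fin n → ℤ) → ℤ} (hF : ∀ x, F x = 0 ∨ F x = 1)
    (hcross : ∀ x, ∑ j, F (x + crossVec n 1 j) = 1) {p : ℕ} [hp : Fact p.Prime]
    (hpn : 2 * n + 1 = p) (x y : Fin n → ℤ) : F (x + (p : ℤ) • y) = F x := by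
  have hstep (x) (hx : F x = 1) (j) : F (x + crossVec n p j) = 1 := by
    have hmod := sum_translate_prime_smul p (crossVec n 1) (fun y => (F y : ZMod p))
      (fun y => by exact_mod_cast congrArg (Int.cast : ℤ → ZMod p) (hcross y)) x
    rw [card_cross, hpn, ZMod.natCast_self,
      zero_pow (Nat.sub_ne_zero_of_lt hp.out.one_lt)] at hmod
    simp only [smul_crossVec, mul_one] at hmod
    have hdvd : (p : ℤ) ∣ ∑ j, F (x + crossVec n p j) := by
      rw [← ZMod.intCast_zmod_eq_zero_iff_dvd]; exact_mod_cast hmod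
    have hle (j) : F (x + crossVec n p j) ≤ 1 := by
      rcases hF (x + crossVec n p j) with h | h <;> omega
    have hpos : 0 < ∑ j, F (x + crossVec n p j) :=
      sum_pos' (fun j _ => by rcases hF (x + crossVec n p j) with h | h <;> omega)
        ⟨none, mem_univ _, by simp [crossVec, hx]⟩
    have hcard : ∑ _j : Option (Fin n ⊕ Fin n), (1 : ℤ) = p := by
      rw [sum_const, card_univ, card_cross, hpn]; simp
    have heq : ∑ j, F (x + crossVec n p j) = ∑ _j : Option (Fin n ⊕ Fin n), (1 : ℤ) :=
      le_antisymm (sum_le_sum fun j _ => hle j) (hcard.trans_le (Int.le_of_dvd hpos hdvd))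
    exact (sum_eq_sum_iff_of_le fun j _ => hle j).1 heq j (mem_univ j)
  have hsingle (i : Fin n) (x) : F (x + Pi.single i (p : ℤ)) = F x := by
    rcases hF x with h | h
    · rcases hF (x + Pi.single i (p : ℤ)) with h' | h'
      · rw [h, h']
      · have := hstep _ h' (some (.inr i))
        rw [crossVec, add_assoc, ← Pi.single_add, add_neg_cancel, Pi.single_zero, add_zero] at this
        omega
    · rw [h, ← hstep x h (some (.inl i)), crossVec]
  let P : AddSubgroup (Fin n → ℤ) :=
    { carrier := {y | ∀ x, F (x + y) = F x}
      zero_mem' := by simp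
      add_mem' := fun {a b} ha hb x => by rw [← add_assoc, hb, ha]
      neg_mem' := fun {a} ha x => by rw [← ha, neg_add_cancel_right] }
  have hmem : (p : ℤ) • y ∈ P := by
    rw [← univ_sum_single ((p : ℤ) • y)]
    refine sum_mem fun i _ => ?_
    have : (Pi.single i (((p : ℤ) • y) i) : Fin n → ℤ) = y i • Pi.single i (p : ℤ) := by
      rw [← Pi.single_smul]; simp [mul_comm]
    rw [this]
    exact zsmul_mem (show Pi.single i (p : ℤ) ∈ P from hsingle i) _
  exact hmem x

end Cross

section DimensionFive

/-- Newton's identity for `b * c * d * e`, with the power sums prescribed through the Chebyshev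
polynomials `u ^ 2 - 2`, `u ^ 3 - 3 * u`, `u ^ 4 - 4 * u ^ 2 + 2`. -/
lemma prod_four_eq_of_chebyshev_sums {A : Type*} [CommRing A] {a b c d e : A}
    (h1 : 1 + (a + b + c + d + e) = 0)
    (h2 : 1 + ((a ^ 2 - 2) + (b ^ 2 - 2) + (c ^ 2 - 2) + (d ^ 2 - 2) + (e ^ 2 - 2)) = 0)
    (h3 : 1 + ((a ^ 3 - 3 * a) + (b ^ 3 - 3 * b) + (c ^ 3 - 3 * c) + (d ^ 3 - 3 * d) +
      (e ^ 3 - 3 * e)) = 0)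
    (h4 : 1 + ((a ^ 4 - 4 * a ^ 2 + 2) + (b ^ 4 - 4 * b ^ 2 + 2) + (c ^ 4 - 4 * c ^ 2 + 2) +
      (d ^ 4 - 4 * d ^ 2 + 2) + (e ^ 4 - 4 * e ^ 2 + 2)) = 0) :
    24 * (b * c * d * e) = 24 * (1 + (a ^ 3 - 3 * a) + (a ^ 4 - 4 * a ^ 2 + 2)) := by
  have p1 : b + c + d + e = -1 - a := by linear_combination h1
  have p2 : b ^ 2 + c ^ 2 + d ^ 2 + e ^ 2 = 9 - a ^ 2 := by linear_combination h2
  have p3 : b ^ 3 + c ^ 3 + d ^ 3 + e ^ 3 = -4 - a ^ 3 := by linear_combination h3 + 3 * h1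
  have p4 : b ^ 4 + c ^ 4 + d ^ 4 + e ^ 4 = 25 - a ^ 4 := by linear_combination h4 + 4 * h2
  have newton : 24 * (b * c * d * e) =
      (b + c + d + e) ^ 4 - 6 * (b + c + d + e) ^ 2 * (b ^ 2 + c ^ 2 + d ^ 2 + e ^ 2) +
      3 * (b ^ 2 + c ^ 2 + d ^ 2 + e ^ 2) ^ 2 +
      8 * (b + c + d + e) * (b ^ 3 + c ^ 3 + d ^ 3 + e ^ 3) -
      6 * (b ^ 4 + c ^ 4 + d ^ 4 + e ^ 4) := by ring
  rw [newton, p1, p2, p3, p4]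
  ring

lemma prod_ite_eq_of_chebyshev_sums {A : Type*} [CommRing A] {u : Fin 5 → A}
    (h1 : 1 + ∑ j, u j = 0) (h2 : 1 + ∑ j, (u j ^ 2 - 2) = 0)
    (h3 : 1 + ∑ j, (u j ^ 3 - 3 * u j) = 0) (h4 : 1 + ∑ j, (u j ^ 4 - 4 * u j ^ 2 + 2) = 0)
    (i : Fin 5) :
    24 * ∏ j, (if j = i then 1 else u j) =
      24 * (1 + (u i ^ 3 - 3 * u i) + (u i ^ 4 - 4 * u i ^ 2 + 2)) := by
  simp only [Fin.sum_univ_five] at h1 h2 h3 h4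
  fin_cases i
  · refine Eq.trans ?_ (prod_four_eq_of_chebyshev_sums (a := u 0) (b := u 1) (c := u 2)
      (d := u 3) (e := u 4) (by linear_combination h1) (by linear_combination h2)
      (by linear_combination h3) (by linear_combination h4))
    simp [Fin.prod_univ_five]
  · refine Eq.trans ?_ (prod_four_eq_of_chebyshev_sums (a := u 1) (b := u 0) (c := u 2)
      (d := u 3) (e := u 4) (by linear_combination h1) (by linear_combination h2)
      (by linear_combination h3) (by linear_combination h4))
    simp [Fin.prod_univ_five]
  · refine Eq.trans ?_ (prod_four_eq_of_chebyshev_sums (a := u 2) (b := u 0) (c := u 1)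
      (d := u 3) (e := u 4) (by linear_combination h1) (by linear_combination h2)
      (by linear_combination h3) (by linear_combination h4))
    simp [Fin.prod_univ_five]
  · refine Eq.trans ?_ (prod_four_eq_of_chebyshev_sums (a := u 3) (b := u 0) (c := u 1)
      (d := u 2) (e := u 4) (by linear_combination h1) (by linear_combination h2)
      (by linear_combination h3) (by linear_combination h4))
    simp [Fin.prod_univ_five]
  · refine Eq.trans ?_ (prod_four_eq_of_chebyshev_sums (a := u 4) (b := u 0) (c := u 1)
      (d := u 2) (e := u 3) (by linear_combination h1) (by linear_combination h2)
      (by linear_combination h3) (by linear_combination h4))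
    simp [Fin.prod_univ_five]

lemma prod_ite_eq_of_laurent_sums {A : Type*} [CommRing A] {X Y : Fin 5 → A}
    (hXY : ∀ j, X j * Y j = 1) (h : ∀ k ∈ Icc 1 4, 1 + ∑ j, (X j ^ k + Y j ^ k) = 0)
    (i : Fin 5) :
    24 * ∏ j, (if j = i then 1 else X j + Y j) =
      24 * (1 + (X i ^ 3 + Y i ^ 3) + (X i ^ 4 + Y i ^ 4)) := by
  have c2 (j) : (X j + Y j) ^ 2 - 2 = X j ^ 2 + Y j ^ 2 := by
    linear_combination 2 * hXY j
  have c3 (j) : (X j + Y j) ^ 3 - 3 * (X j + Y j) = X j ^ 3 + Y j ^ 3 := by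
    linear_combination 3 * (X j + Y j) * hXY j
  have c4 (j) : (X j + Y j) ^ 4 - 4 * (X j + Y j) ^ 2 + 2 = X j ^ 4 + Y j ^ 4 := by
    linear_combination (4 * (X j ^ 2 + Y j ^ 2) + 6 * X j * Y j - 2) * hXY j
  have hprod := prod_ite_eq_of_chebyshev_sums (u := fun j => X j + Y j)
    (by simpa using h 1 (by simp)) (by simpa only [c2] using h 2 (by simp))
    (by simpa only [c3] using h 3 (by simp)) (by simpa only [c4] using h 4 (by simp)) i
  simpa only [c3, c4] using hprod

/-- The vectors with `i`-th coordinate `0` and all others `±1`. -/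
def signVectors (i : Fin 5) : Finset (Fin 5 → ℤ) :=
  Fintype.piFinset fun j => if j = i then {0} else {1, -1}

lemma card_signVectors (i : Fin 5) : #(signVectors i) = 16 := by
  fin_cases i <;> rfl

lemma sum_single_crossVec {n : ℕ} (k : ℕ) :
    ∑ j, AddMonoidAlgebra.single (crossVec n k j) (1 : ℤ) =
      1 + ∑ i, (AddMonoidAlgebra.single (Pi.single i 1) 1 ^ k +
        AddMonoidAlgebra.single (Pi.single i (-1)) 1 ^ k) := by
  simp [Fintype.sum_option, crossVec, AddMonoidAlgebra.single_pow, ← Pi.single_smul,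
    sum_add_distrib, AddMonoidAlgebra.one_def]

lemma sum_single_signVectors (i : Fin 5) :
    ∑ p ∈ signVectors i, AddMonoidAlgebra.single p (1 : ℤ) =
      ∏ j, (if j = i then 1 else AddMonoidAlgebra.single (Pi.single j 1) 1 +
        AddMonoidAlgebra.single (Pi.single j (-1)) 1) := by
  have h (p : Fin 5 → ℤ) : AddMonoidAlgebra.single p (1 : ℤ) =
      ∏ j, AddMonoidAlgebra.single (Pi.single j (p j)) 1 := by
    conv_lhs => rw [← univ_sum_single p]
    exact map_prod (AddMonoidAlgebra.of ℤ (Fin 5 → ℤ))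
      (fun j => Multiplicative.ofAdd (Pi.single j (p j))) univ
  rw [sum_congr rfl fun p _ => h p, signVectors,
    ← prod_univ_sum _ (fun j s => AddMonoidAlgebra.single (Pi.single j s) (1 : ℤ))]
  refine prod_congr rfl fun j _ => ?_
  split_ifs
  · simp [AddMonoidAlgebra.one_def]
  · rw [sum_pair (by norm_num)]

/-- A function tiling with the crosses of arm lengths `1, 2, 3, 4` has determined sums over the
translates of `signVectors i`. -/
lemma sum_signVectors {F : (Fin 5 → ℤ) → ℤ}
    (hcross : ∀ k ∈ Icc 1 4, ∀ x, ∑ j, F (x + crossVec 5 (k : ℕ) j) = 1)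
    (i : Fin 5) (x : Fin 5 → ℤ) :
    ∑ p ∈ signVectors i, F (x + p) = 1 + F x + F (x + Pi.single i 3) + F (x + Pi.single i (-3)) +
      F (x + Pi.single i 4) + F (x + Pi.single i (-4)) := by
  let f : (Fin 5 → ℤ) → ℤ := fun x => 11 * F x - 1
  let X (j : Fin 5) : AddMonoidAlgebra ℤ (Fin 5 → ℤ) := AddMonoidAlgebra.single (Pi.single j 1) 1
  let Y (j : Fin 5) : AddMonoidAlgebra ℤ (Fin 5 → ℤ) :=
    AddMonoidAlgebra.single (Pi.single j (-1)) 1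
  let π := Ideal.Quotient.mk (annihilatorIdeal f)
  have hXY (j) : π (X j) * π (Y j) = 1 := by
    rw [← map_mul, AddMonoidAlgebra.single_mul_single, ← Pi.single_add]
    simp [← AddMonoidAlgebra.one_def]
  have hker (k) (hk : k ∈ Icc 1 4) : 1 + ∑ j, (π (X j) ^ k + π (Y j) ^ k) = 0 := by
    have : ∑ j, AddMonoidAlgebra.single (crossVec 5 k j) (1 : ℤ) ∈ annihilatorIdeal f := by
      rw [mem_annihilatorIdeal]
      funext y
      rw [groupAlgebraAction_sum_single]
      simp [f, sum_sub_distrib, ← mul_sum, hcross k hk]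
    rw [sum_single_crossVec, ← Ideal.Quotient.eq_zero_iff_mem] at this
    simpa only [map_add, map_one, map_sum, map_pow] using this
  have hmem : 24 * ((∑ p ∈ signVectors i, AddMonoidAlgebra.single p (1 : ℤ)) -
      (1 + (X i ^ 3 + Y i ^ 3) + (X i ^ 4 + Y i ^ 4))) ∈ annihilatorIdeal f := by
    rw [← Ideal.Quotient.eq_zero_iff_mem, sum_single_signVectors]
    have := prod_ite_eq_of_laurent_sums hXY hker i
    simp only [map_mul, map_sub, map_add, map_pow, map_one, map_prod, map_ofNat, apply_ite]
    linear_combination this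
  have hX (k : ℕ) : X i ^ k = AddMonoidAlgebra.single (Pi.single i (k : ℤ)) 1 := by
    simp [X, AddMonoidAlgebra.single_pow, ← Pi.single_smul, -nsmul_eq_mul]
  have hY (k : ℕ) : Y i ^ k = AddMonoidAlgebra.single (Pi.single i (-k : ℤ)) 1 := by
    simp [Y, AddMonoidAlgebra.single_pow, ← Pi.single_smul, -nsmul_eq_mul]
  have heval := congrFun (mem_annihilatorIdeal.1 hmem) x
  have h24 : (24 : AddMonoidAlgebra ℤ (Fin 5 → ℤ)) = AddMonoidAlgebra.single 0 24 := rfl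
  rw [h24, map_mul, Module.End.mul_apply, groupAlgebraAction_single, map_sub, LinearMap.sub_apply,
    Pi.sub_apply, groupAlgebraAction_sum_single] at heval
  simp only [hX, hY, AddMonoidAlgebra.one_def, map_add, LinearMap.add_apply, Pi.add_apply,
    groupAlgebraAction_single, Pi.zero_apply, add_zero, f, sum_sub_distrib, ← mul_sum,
    sum_const, card_signVectors] at heval
  norm_num at heval
  linarith

end DimensionFive

/-- In a perfect Lee code of radius 1 in `ℤ^5` containing the origin there is no
codeword of type [5^1], and the codewords with all coordinates `±1` are exactly
a pair `{M, -M}` of negatives of each other. -/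
theorem dim5_51_and_15 (T : Set (Fin 5 → ℤ)) (hT : PerfectLeeCode 5 T) (h0 : 0 ∈ T) :
    (∀ W ∈ T, ¬∃ i, |W i| = 5 ∧ ∀ k, k ≠ i → W k = 0) ∧
    (∃ M : Fin 5 → ℤ, (∀ i, |M i| = 1) ∧ M ≠ -M ∧
      {V | V ∈ T ∧ ∀ i, |V i| = 1} = {M, -M}) := by
  classical
  let F : (Fin 5 → ℤ) → ℤ := fun x => if x ∈ T then 1 else 0
  have hF (x) : F x = 0 ∨ F x = 1 := by simp only [F]; split_ifs <;> simp
  have hF0 (x) : 0 ≤ F x := by rcases hF x with h | h <;> omega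
  have hFT (x) : F x = 1 ↔ x ∈ T := by simp [F]
  have hzero : F 0 = 1 := (hFT 0).2 h0
  have cross_one (x) : ∑ j, F (x + crossVec 5 1 j) = 1 := hT.sum_indicator x
  have : Fact (Nat.Prime 11) := ⟨by norm_num⟩
  have : Fact (Nat.Prime 5) := ⟨by norm_num⟩
  have hper := periodic_of_sum_crossVec (p := 11) hF cross_one rfl
  have dilate (p : ℕ) [Fact p.Prime] (hp : ¬ p ∣ 11) (k : ℤ)
      (hk : ∀ x, ∑ j, F (x + crossVec 5 k j) = 1) (x) :
      ∑ j, F (x + crossVec 5 (p * k) j) = 1 := by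
    simpa only [smul_crossVec] using
      sum_translate_dilate hF0 hper (crossVec 5 k) hk p (by rwa [card_cross]) x
  have cross_two := dilate 2 (by norm_num) 1 cross_one
  have hcross (k : ℕ) (hk : k ∈ Icc 1 5) (x) : ∑ j, F (x + crossVec 5 k j) = 1 := by
    obtain ⟨h1, h5⟩ := mem_Icc.1 hk
    interval_cases k
    · exact cross_one x
    · exact cross_two x
    · exact dilate 3 (by norm_num) 1 cross_one x
    · exact dilate 2 (by norm_num) _ cross_two x
    · exact dilate 5 (by norm_num) 1 cross_one x
  have haxis (i : Fin 5) (k : ℤ) (hk : 1 ≤ |k| ∧ |k| ≤ 5) : F (Pi.single i k) = 0 := by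
    have hsum := hcross k.natAbs (mem_Icc.2 (by grind)) (Pi.single i k)
    obtain ⟨j, hj, hjk⟩ : ∃ j, none ≠ j ∧ Pi.single i k + crossVec 5 k.natAbs j = 0 := by
      rcases abs_choice k with h | h
      · exact ⟨some (.inr i), by simp, by simp [crossVec, h, ← Pi.single_add]⟩
      · exact ⟨some (.inl i), by simp, by simp [crossVec, h, ← Pi.single_add]⟩
    have hle := sum_le_univ_sum_of_nonneg (s := {none, j})
      (fun l => hF0 (Pi.single i k + crossVec 5 k.natAbs l))
    rw [hsum, sum_pair hj, hjk, hzero] at hle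
    simp only [crossVec, add_zero] at hle
    linarith [hF0 (Pi.single i k)]
  refine ⟨?_, ?_⟩
  · rintro W hW ⟨i, hi, hk⟩
    have hWi : W = Pi.single i (W i) := by
      ext k
      by_cases h : k = i
      · subst h; simp
      · simp [h, hk]
    have := haxis i (W i) (by omega)
    rw [← hWi, (hFT W).2 hW] at this
    omega
  · have hunique (i : Fin 5) (σ : ℤ) (hσ : |σ| = 1) :
        ∃! M, M ∈ T ∧ (∀ j, |M j| = 1) ∧ M i = σ := by
      have hsum := sum_signVectors (fun k hk => hcross k (by simp at hk ⊢; omega)) i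
        (Pi.single i σ)
      simp only [← Pi.single_add] at hsum
      have hσ' := eq_or_eq_neg_of_abs_eq hσ
      rw [haxis i σ (by omega), haxis i _ (by grind), haxis i _ (by grind), haxis i _ (by grind),
        haxis i _ (by grind)] at hsum
      have hcard : #{p ∈ signVectors i | Pi.single i σ + p ∈ T} = 1 := by
        rw [card_filter]
        simp only [F, add_zero] at hsum
        exact_mod_cast hsum
      obtain ⟨p, hp⟩ := card_eq_one.1 hcard
      have hiff (M : Fin 5 → ℤ) : (M ∈ T ∧ (∀ j, |M j| = 1) ∧ M i = σ) ↔ M - Pi.single i σ = p := by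
        rw [← mem_singleton (a := p), ← hp, mem_filter, add_sub_cancel, and_comm]
        refine and_congr_left' ?_
        simp only [signVectors, Fintype.mem_piFinset, Pi.sub_apply, Pi.single_apply]
        constructor
        · rintro ⟨hM, hMi⟩ j
          have := eq_or_eq_neg_of_abs_eq (hM j)
          split_ifs with h
          · subst h; simp [hMi]
          · simpa using this
        · intro hM
          have hMi : M i = σ := by simpa [sub_eq_zero] using hM i
          refine ⟨fun j => ?_, hMi⟩
          by_cases h : j = i
          · rw [h, hMi, hσ]
          · rcases (by simpa [h] using hM j : M j = 1 ∨ M j = -1) with h' | h' <;> simp [h']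
      refine ⟨p + Pi.single i σ, (hiff _).2 (by simp), fun M hM => ?_⟩
      rw [← (hiff M).1 hM, sub_add_cancel]
    obtain ⟨M, ⟨hMT, hM, hM0⟩, hMuniq⟩ := hunique 0 1 rfl
    obtain ⟨N, ⟨hNT, hN, hN0⟩, hNuniq⟩ := hunique 0 (-1) rfl
    have hne : M ≠ N := by rintro rfl; omega
    have hNM : N = -M := by
      funext i
      have hi : M i ≠ N i := fun h =>
        hne ((hunique i (N i) (hN i)).unique ⟨hMT, hM, h⟩ ⟨hNT, hN, rfl⟩)
      have := eq_or_eq_neg_of_abs_eq (hM i)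
      have := eq_or_eq_neg_of_abs_eq (hN i)
      simp only [Pi.neg_apply]
      omega
    refine ⟨M, hM, hNM ▸ hne, Set.ext fun V => ?_⟩
    simp only [Set.mem_ofPred_eq, Set.mem_insert_iff, Set.mem_singleton_iff, ← hNM]
    constructor
    · rintro ⟨hVT, hV⟩
      rcases eq_or_eq_neg_of_abs_eq (hV 0) with h | h
      · exact .inl (hMuniq V ⟨hVT, hV, h⟩)
      · exact .inr (hNuniq V ⟨hVT, hV, h⟩)
    · rintro (rfl | rfl)
      · exact ⟨hMT, hM⟩
      · exact ⟨hNT, hN⟩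
end
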